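/- The map (A,B) ↦ det(I,A,A²,B,B²,AB,BA,[A,[A,B]],[B,[B,A]]) + 9(det[A,B])²H([A,B]) is identically zero as a polynomial function on pairs of 3×3 matrices over ℚ (i.e., the corrected identity holds over the rationals). -/

import Mathlib

open Matrix Polynomial

/-- Determinant of the 9×9 matrix whose columns are the vectorizations of nine 3×3 matrices. -/
noncomputable def vecDet {K : Type*} [CommRing K]
    (v : Fin 9 → Matrix (Fin 3) (Fin 3) K) : K :=
  Matrix.det (Matrix.of fun p q : Fin 3 × Fin 3 =>
    v (finProdFinEquiv q) p.1 p.2)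

/-- H(M) = (tr(M)² − tr(M²))/2. -/
noncomputable def Hm {K : Type*} [Field K] (M : Matrix (Fin 3) (Fin 3) K) : K :=
  (Matrix.trace M ^ 2 - Matrix.trace (M * M)) / 2

/-- The nine matrices I, A, A², B, B², AB, BA, [A,[A,B]], [B,[B,A]]. -/
def nine {K : Type*} [CommRing K] (A B : Matrix (Fin 3) (Fin 3) K) :
    Fin 9 → Matrix (Fin 3) (Fin 3) K :=
  ![1, A, A ^ 2, B, B ^ 2, A * B, B * A,
    A * (A * B - B * A) - (A * B - B * A) * A,
    B * (B * A - A * B) - (B * A - A * B) * B]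

theorem vecDet_eq_det_mul {K : Type*} [CommRing K] {v w : Fin 9 → Matrix (Fin 3) (Fin 3) K}
    (U : Matrix (Fin 9) (Fin 9) K) (h : ∀ j, w j = ∑ i, U i j • v i) :
    vecDet w = U.det * vecDet v := by
  have hU : U.det = (U.submatrix (finProdFinEquiv (m := 3) (n := 3)) finProdFinEquiv).det :=
    (Matrix.det_submatrix_equiv_self (finProdFinEquiv (m := 3) (n := 3)) U).symm
  rw [vecDet, vecDet, mul_comm U.det, hU, ← Matrix.det_mul]
  congr 1
  ext p q
  rw [Matrix.of_apply, h, Matrix.mul_apply]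
  refine (Matrix.sum_apply _ _ _ _).trans ((Equiv.sum_comp (finProdFinEquiv (m := 3) (n := 3))
    fun i => (U i (finProdFinEquiv q) • v i) p.1 p.2).symm.trans ?_)
  exact Finset.sum_congr rfl fun i _ => mul_comm _ _

theorem vecDet_conj {K : Type*} [CommRing K] (v : Fin 9 → Matrix (Fin 3) (Fin 3) K)
    {P Q : Matrix (Fin 3) (Fin 3) K} (hPQ : P * Q = 1) :
    vecDet (fun i => P * v i * Q) = vecDet v := by
  have hdet : P.det * Q.det = 1 := by rw [← Matrix.det_mul, hPQ, Matrix.det_one]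
  have : (Matrix.of fun p q : Fin 3 × Fin 3 => (P * v (finProdFinEquiv q) * Q) p.1 p.2)
      = Matrix.kroneckerMap (· * ·) P Qᵀ *
        Matrix.of fun p q : Fin 3 × Fin 3 => v (finProdFinEquiv q) p.1 p.2 := by
    ext p q
    simp only [Matrix.of_apply, Matrix.mul_apply, Fintype.sum_prod_type,
      Matrix.kroneckerMap_apply, Matrix.transpose_apply, Finset.sum_mul]
    rw [Finset.sum_comm]
    exact Finset.sum_congr rfl fun _ _ => Finset.sum_congr rfl fun _ _ => by ring
  rw [vecDet, this, Matrix.det_mul, Matrix.det_kronecker, Matrix.det_transpose, ← mul_pow, hdet,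
    one_pow, one_mul, vecDet]

/-- The nine words I, A, A², B, B², AB, BA, ABA, BAB. -/
def nineWords {K : Type*} [CommRing K] (A B : Matrix (Fin 3) (Fin 3) K) :
    Fin 9 → Matrix (Fin 3) (Fin 3) K :=
  ![1, A, A ^ 2, B, B ^ 2, A * B, B * A, A * B * A, B * A * B]

theorem cayleyHamilton_polarized {K : Type*} [Field K] [CharZero K]
    (A B : Matrix (Fin 3) (Fin 3) K) :
    A * (A * B - B * A) - (A * B - B * A) * A =
      (-3 : K) • (A * B * A) + A.trace • (A * B) + A.trace • (B * A) + B.trace • A ^ 2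
        - Hm A • B - (A.trace * B.trace - (A * B).trace) • A
        + ((A * A * B).trace - A.trace * (A * B).trace + Hm A * B.trace) •
          (1 : Matrix (Fin 3) (Fin 3) K) := by
  ext i j
  fin_cases i <;> fin_cases j <;>
    simp [Hm, pow_two, Matrix.mul_apply, Fin.sum_univ_three, Matrix.trace_fin_three] <;> ring

theorem vecDet_nine_eq {K : Type*} [Field K] [CharZero K] (A B : Matrix (Fin 3) (Fin 3) K) :
    vecDet (nine A B) = 9 * vecDet (nineWords A B) := by
  have hA := cayleyHamilton_polarized A B
  have hB := cayleyHamilton_polarized B A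
  set a := (A * A * B).trace - A.trace * (A * B).trace + Hm A * B.trace
  set b := (B * B * A).trace - B.trace * (B * A).trace + Hm B * A.trace
  set a' := A.trace * B.trace - (A * B).trace
  set b' := B.trace * A.trace - (B * A).trace
  let U : Matrix (Fin 9) (Fin 9) K :=
    !![1, 0, 0, 0, 0, 0, 0, a, b;
       0, 1, 0, 0, 0, 0, 0, -a', -Hm B;
       0, 0, 1, 0, 0, 0, 0, B.trace, 0;
       0, 0, 0, 1, 0, 0, 0, -Hm A, -b';
       0, 0, 0, 0, 1, 0, 0, 0, A.trace;
       0, 0, 0, 0, 0, 1, 0, A.trace, B.trace;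
       0, 0, 0, 0, 0, 0, 1, A.trace, B.trace;
       0, 0, 0, 0, 0, 0, 0, -3, 0;
       0, 0, 0, 0, 0, 0, 0, 0, -3]
  have hU : U.det = 9 := by
    rw [Matrix.det_of_isUpperTriangular]
    · simp [U, Fin.prod_univ_succ]; norm_num
    · intro i j hij
      fin_cases i <;> fin_cases j <;> first | rfl | exact absurd hij (by decide)
  rw [← hU]
  refine vecDet_eq_det_mul U fun j => ?_
  fin_cases j <;> simp [U, nine, nineWords, Fin.sum_univ_succ]
  · rw [hA]; module
  · rw [hB]; module

theorem vecDet_nineWords_add_scalar {K : Type*} [CommRing K] (A B : Matrix (Fin 3) (Fin 3) K)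
    (s : K) : vecDet (nineWords (A + s • 1) B) = vecDet (nineWords A B) := by
  let U : Matrix (Fin 9) (Fin 9) K :=
    !![1, s, s ^ 2, 0, 0, 0, 0, 0, 0;
       0, 1, 2 * s, 0, 0, 0, 0, 0, 0;
       0, 0, 1, 0, 0, 0, 0, 0, 0;
       0, 0, 0, 1, 0, s, s, s ^ 2, 0;
       0, 0, 0, 0, 1, 0, 0, 0, s;
       0, 0, 0, 0, 0, 1, 0, s, 0;
       0, 0, 0, 0, 0, 0, 1, s, 0;
       0, 0, 0, 0, 0, 0, 0, 1, 0;
       0, 0, 0, 0, 0, 0, 0, 0, 1]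
  have hU : U.det = 1 := by
    rw [Matrix.det_of_isUpperTriangular]
    · simp [U, Fin.prod_univ_succ]
    · intro i j hij
      fin_cases i <;> fin_cases j <;> first | rfl | exact absurd hij (by decide)
  rw [← one_mul (vecDet (nineWords A B)), ← hU]
  refine vecDet_eq_det_mul U fun j => ?_
  fin_cases j <;>
    simp [U, nineWords, Fin.sum_univ_succ, pow_two, add_mul, mul_add, smul_smul] <;> module

theorem vecDet_eq_det_six {K : Type*} [CommRing K] (v : Fin 9 → Matrix (Fin 3) (Fin 3) K)
    (h : ∀ i j : Fin 3, v (Fin.castAdd 6 i) 0 j = (1 : Matrix (Fin 3) (Fin 3) K) i j) :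
    vecDet v = (Matrix.of fun k l : Fin 6 =>
      let p : Fin 3 × Fin 3 := finProdFinEquiv.symm (Fin.natAdd 3 k)
      v (Fin.natAdd 3 l) p.1 p.2 -
        ∑ m, v (Fin.castAdd 6 m) p.1 p.2 * v (Fin.natAdd 3 l) 0 m).det := by
  let e : Fin 3 ⊕ Fin 6 ≃ Fin 3 × Fin 3 :=
    (finSumFinEquiv (m := 3) (n := 6)).trans (finProdFinEquiv (m := 3) (n := 3)).symm
  have he : ∀ i, e (Sum.inl i) = (0, i) := by decide
  rw [vecDet, ← Matrix.det_submatrix_equiv_self e,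
    ← Matrix.fromBlocks_toBlocks (Matrix.submatrix _ e e)]
  have h1 : (Matrix.submatrix (Matrix.of fun p q : Fin 3 × Fin 3 =>
      v (finProdFinEquiv q) p.1 p.2) e e).toBlocks₁₁ = 1 := by
    ext i j
    have := h j i
    rw [Matrix.one_apply] at this ⊢
    simp only [Matrix.toBlocks₁₁, Matrix.of_apply, Matrix.submatrix_apply, he]
    simp only [eq_comm (a := i)]
    rw [← this]
    rfl
  rw [h1, Matrix.det_fromBlocks_one₁₁]
  congr 1
  ext k l
  have her : ∀ k, e (Sum.inr k) = finProdFinEquiv.symm (Fin.natAdd 3 k) := fun _ => rfl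
  have hl : ∀ j : Fin 3, v (finProdFinEquiv ((0 : Fin 3), j)) = v (Fin.castAdd 6 j) :=
    fun j => congrArg v (by revert j; decide)
  have hr : ∀ k : Fin 6, v (finProdFinEquiv (e (Sum.inr k))) = v (Fin.natAdd 3 k) :=
    fun k => congrArg v (by revert k; decide)
  simp only [Matrix.sub_apply, Matrix.mul_apply, Matrix.toBlocks₂₂, Matrix.toBlocks₂₁,
    Matrix.toBlocks₁₂, Matrix.submatrix_apply, Matrix.of_apply, hr, he, hl]
  simp only [her]

set_option maxHeartbeats 20000000 in
set_option maxRecDepth 100000 in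
theorem det_reduced_nineWords {K : Type*} [Field K] [CharZero K] (c d p q r s t u : K) :
    Matrix.det
      !![p, p * q + r * s, s - c * r, c * r, c * u - c * q, p ^ 2 + q * s + d * p * r;
         q, q ^ 2 + r * t, t - p - d * r, p + d * r, s - c * r + d * u - d * q,
          p * q + q * t + d * q * r;
         r, q * r + r * u, u - q, q, t - p - d * r, p * r + q * u + d * r ^ 2;
         s, p * t + s * u, d * p - c * q, c * u, -c * p, p * s + s * t + d * p * u;
         t, q * t + t * u, -c * r, s + d * u, -c * q, q * s + t ^ 2 + d * q * u;
         u, r * t + u ^ 2, -p, t, -c * r, r * s + t * u + d * r * u] =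
    -(Matrix.det
      !![p, q, r;
         s - c * r, t - p - d * r, u - q;
         d * p - c * u, d * q - s - d * u, d * r - t]) ^ 2 *
     Hm !![p, q, r;
         s - c * r, t - p - d * r, u - q;
         d * p - c * u, d * q - s - d * u, d * r - t] := by
  simp [Matrix.det_succ_row_zero, Fin.sum_univ_succ, Fin.succAbove, Hm, Matrix.trace_fin_three]
  ring

set_option maxHeartbeats 2000000 in
theorem vecDet_nineWords_companion {K : Type*} [Field K] [CharZero K] (c d : K)
    (B : Matrix (Fin 3) (Fin 3) K) :
    let C : Matrix (Fin 3) (Fin 3) K := !![0, 1, 0; 0, 0, 1; c, d, 0]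
    vecDet (nineWords C B) = -(C * B - B * C).det ^ 2 * Hm (C * B - B * C) := by
  intro C
  obtain ⟨x, y, z, p, q, r, s, t, u, hB⟩ : ∃ x y z p q r s t u : K,
      B = !![x, y, z; p + c * z, q + x + d * z, r + y;
        s + c * y, t + d * y + c * z, u + x + d * z] := by
    refine ⟨B 0 0, B 0 1, B 0 2, B 1 0 - c * B 0 2, B 1 1 - B 0 0 - d * B 0 2, B 1 2 - B 0 1,
      B 2 0 - c * B 0 1, B 2 1 - d * B 0 1 - c * B 0 2, B 2 2 - B 0 0 - d * B 0 2, ?_⟩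
    ext i j
    fin_cases i <;> fin_cases j <;> simp <;> ring
  have hK : C * B - B * C = !![p, q, r;
         s - c * r, t - p - d * r, u - q;
         d * p - c * u, d * q - s - d * u, d * r - t] := by
    rw [hB]
    ext i j
    fin_cases i <;> fin_cases j <;> simp [C] <;> ring
  let U : Matrix (Fin 6) (Fin 6) K :=
    !![1, 2 * x + d * z, 0, 0, 0, d * y + 2 * c * z;
       0, 1, 0, 0, 0, 0;
       0, y, 1, 0, 0, x + d * z;
       0, y, 0, 1, 0, x + d * z;
       0, -z, 0, 0, 1, -y;
       0, 0, 0, 0, 0, 1]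
  have hU : U.det = 1 := by
    simp [U, Matrix.det_succ_column_zero, Fin.sum_univ_succ, Fin.succAbove]
  rw [hK, ← det_reduced_nineWords, ← mul_one (Matrix.det _), ← hU, ← Matrix.det_mul,
    vecDet_eq_det_six]
  · congr 1
    rw [hB]
    have hk : ∀ k : Fin 6, finProdFinEquiv.symm (Fin.natAdd 3 k) =
      (![(1, 0), (1, 1), (1, 2), (2, 0), (2, 1), (2, 2)] k : Fin 3 × Fin 3) := by decide
    ext k l
    simp only [hk, Matrix.of_apply]
    fin_cases k <;> fin_cases l <;>
      simp [C, U, nineWords, pow_two, Matrix.mul_apply, Fin.sum_univ_succ] <;> ring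
  · intro i j
    fin_cases i <;> fin_cases j <;> simp [C, nineWords, pow_two]

theorem exists_conj_companion {K : Type*} [Field K] (A : Matrix (Fin 3) (Fin 3) K)
    (hA : (Matrix.of ![(1 : Matrix (Fin 3) (Fin 3) K) 0, A 0, (A * A) 0]).det ≠ 0)
    (htr : A.trace = 0) :
    ∃ P Q : Matrix (Fin 3) (Fin 3) K, ∃ c d : K, P * Q = 1 ∧ Q * P = 1 ∧
      P * A * Q = !![0, 1, 0; 0, 0, 1; c, d, 0] := by
  set P : Matrix (Fin 3) (Fin 3) K :=
    Matrix.of ![(1 : Matrix (Fin 3) (Fin 3) K) 0, A 0, (A * A) 0] with hP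
  have hu : IsUnit P.det := isUnit_iff_ne_zero.mpr hA
  refine ⟨P, P⁻¹, A.det, -(A 0 0 * A 1 1 - A 0 1 * A 1 0 + A 0 0 * A 2 2 - A 0 2 * A 2 0
    + A 1 1 * A 2 2 - A 1 2 * A 2 1), P.mul_nonsing_inv hu, P.nonsing_inv_mul hu, ?_⟩
  have h : P * A = !![0, 1, 0; 0, 0, 1; A.det, -(A 0 0 * A 1 1 - A 0 1 * A 1 0 + A 0 0 * A 2 2
      - A 0 2 * A 2 0 + A 1 1 * A 2 2 - A 1 2 * A 2 1), 0] * P := by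
    have h22 : A 2 2 = -A 0 0 - A 1 1 := by
      rw [Matrix.trace_fin_three] at htr
      linear_combination htr
    ext i j
    fin_cases i <;> fin_cases j <;>
      simp [hP, Matrix.mul_apply, Fin.sum_univ_three, Matrix.det_fin_three, h22] <;> ring
  rw [h, Matrix.mul_assoc, P.mul_nonsing_inv hu, Matrix.mul_one]

theorem nineWords_conj {K : Type*} [CommRing K] (A B : Matrix (Fin 3) (Fin 3) K)
    {P Q : Matrix (Fin 3) (Fin 3) K} (hPQ : P * Q = 1) (hQP : Q * P = 1) :
    nineWords (P * A * Q) (P * B * Q) = fun i => P * nineWords A B i * Q := by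
  have h : ∀ X Y : Matrix (Fin 3) (Fin 3) K, P * X * Q * (P * Y * Q) = P * (X * Y) * Q := by
    intro X Y
    calc P * X * Q * (P * Y * Q) = P * X * (Q * P) * Y * Q := by noncomm_ring
      _ = P * (X * Y) * Q := by rw [hQP]; noncomm_ring
  funext i
  fin_cases i <;> simp [nineWords, pow_two, h, hPQ]

theorem vecDet_nineWords_of_trace_eq_zero {K : Type*} [Field K] [CharZero K]
    (A B : Matrix (Fin 3) (Fin 3) K)
    (hA : (Matrix.of ![(1 : Matrix (Fin 3) (Fin 3) K) 0, A 0, (A * A) 0]).det ≠ 0)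
    (htr : A.trace = 0) :
    vecDet (nineWords A B) = -(A * B - B * A).det ^ 2 * Hm (A * B - B * A) := by
  obtain ⟨P, Q, c, d, hPQ, hQP, hC⟩ := exists_conj_companion A hA htr
  have key := vecDet_nineWords_companion c d (P * B * Q)
  have hcomm : P * A * Q * (P * B * Q) - P * B * Q * (P * A * Q) = P * (A * B - B * A) * Q := by
    calc _ = P * A * (Q * P) * B * Q - P * B * (Q * P) * A * Q := by noncomm_ring
      _ = _ := by rw [hQP]; noncomm_ring
  have hdet : P.det * Q.det = 1 := by rw [← Matrix.det_mul, hPQ, Matrix.det_one]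
  have htrace : ∀ X : Matrix (Fin 3) (Fin 3) K, (P * X * Q).trace = X.trace := fun X => by
    rw [Matrix.trace_mul_comm, ← Matrix.mul_assoc, hQP, Matrix.one_mul]
  have hsq : ∀ X : Matrix (Fin 3) (Fin 3) K, P * X * Q * (P * X * Q) = P * (X * X) * Q :=
    fun X => by
      calc P * X * Q * (P * X * Q) = P * X * (Q * P) * X * Q := by noncomm_ring
        _ = P * (X * X) * Q := by rw [hQP]; noncomm_ring
  simp only [← hC] at key
  rw [nineWords_conj A B hPQ hQP, vecDet_conj _ hPQ, hcomm] at key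
  rw [key, Hm, Hm, hsq, htrace, htrace, Matrix.det_mul, Matrix.det_mul, mul_right_comm, hdet,
    one_mul]

theorem vecDet_nine_of_det_ne_zero {K : Type*} [Field K] [CharZero K]
    (A B : Matrix (Fin 3) (Fin 3) K)
    (hA : (Matrix.of ![(1 : Matrix (Fin 3) (Fin 3) K) 0, A 0, (A * A) 0]).det ≠ 0) :
    vecDet (nine A B) + 9 * (A * B - B * A).det ^ 2 * Hm (A * B - B * A) = 0 := by
  set s : K := -A.trace / 3
  have hcomm : (A + s • 1) * B - B * (A + s • 1) = A * B - B * A := by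
    simp [add_mul, mul_add]
  have htr : (A + s • (1 : Matrix (Fin 3) (Fin 3) K)).trace = 0 := by
    simp [s]
  rw [vecDet_nine_eq, ← vecDet_nineWords_add_scalar A B s,
    vecDet_nineWords_of_trace_eq_zero _ B _ htr, hcomm]
  · ring
  · convert! hA using 1
    simp [Matrix.det_fin_three, Matrix.mul_apply, Fin.sum_univ_three]
    ring

theorem continuous_vecDet_nine (B : Matrix (Fin 3) (Fin 3) ℚ) :
    Continuous fun A : Matrix (Fin 3) (Fin 3) ℚ => vecDet (nine A B) := by
  refine Continuous.matrix_det (continuous_matrix fun p q => ?_)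
  refine Continuous.matrix_elem (A := fun A => nine A B (finProdFinEquiv q)) ?_ p.1 p.2
  generalize (finProdFinEquiv q : Fin 9) = j
  fin_cases j <;> simp [nine] <;> fun_prop

theorem stmt_17 (A B : Matrix (Fin 3) (Fin 3) ℚ) :
    vecDet (nine A B) + 9 * ((A * B - B * A).det) ^ 2 * Hm (A * B - B * A) = 0 := by
  let N : Matrix (Fin 3) (Fin 3) ℚ := !![0, 1, 0; 0, 0, 1; 0, 0, 0]
  let A' : ℚ → Matrix (Fin 3) (Fin 3) ℚ := fun t => A + t • N
  let S : Set ℚ :=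
    {t | (Matrix.of ![(1 : Matrix (Fin 3) (Fin 3) ℚ) 0, A' t 0, (A' t * A' t) 0]).det = 0}
  have hS : S.Finite := by
    let k := A 0 2 * (A 2 2 - A 1 1)
    let f : ℚ[X] := X ^ 3 + C (2 * A 0 1 + A 1 2) * X ^ 2 +
      C (A 0 1 ^ 2 + 2 * A 0 1 * A 1 2 + k) * X +
      C (A 0 1 ^ 2 * A 1 2 + A 0 1 * k - A 0 2 ^ 2 * A 2 1)
    have hf : f ≠ 0 := by
      have : f.Monic := by simp only [f]; monicity!
      exact this.ne_zero
    refine (Polynomial.finite_setOfPred_isRoot hf).subset fun t ht => ?_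
    rw [Set.mem_ofPred_eq, Polynomial.IsRoot, ← (show _ = (0 : ℚ) from ht)]
    simp [f, k, A', N, Matrix.det_fin_three, Matrix.mul_apply, Fin.sum_univ_three]
    ring
  have hA' : Continuous A' := by fun_prop
  have hcont : Continuous fun t => vecDet (nine (A' t) B) +
      9 * ((A' t * B - B * A' t).det) ^ 2 * Hm (A' t * B - B * A' t) := by
    have h := (continuous_vecDet_nine B).comp hA'
    simp only [Hm]
    fun_prop
  have hdense : Dense Sᶜ := Rat.dense_compl_compact hS.isCompact
  have heq := hcont.ext_on hdense continuous_const fun t ht =>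
    vecDet_nine_of_det_ne_zero (A' t) B ht
  simpa [A'] using congrFun heq 0
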